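/- (Diophantine frequencies have full measure.) Let n ≥ 1 and τ > n−1. Then the set R^τ = {ω ∈ ℝⁿ : for every α > 0 there exists k ∈ ℤⁿ, k ≠ 0, with |⟨k,ω⟩| < α/|k|₁^τ} has Lebesgue measure zero. Equivalently, its complement Δ^τ = ⋃_{α>0} Δ_α^τ, the set of all ω ∈ ℝⁿ satisfying |⟨k,ω⟩| ≥ α/|k|₁^τ for all k ≠ 0 for some α > 0, has full Lebesgue measure in ℝⁿ (i.e. almost every ω ∈ ℝⁿ lies in Δ^τ). -/

import Mathlib

open MeasureTheory

/-- Summability of negative powers of the sup norm over the integer lattice. -/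
lemma dioph_summable (n : ℕ) (r : ℝ) (hr : r < -(n : ℝ)) :
    Summable fun k : Fin n → ℤ => ‖k‖ ^ r := by
  let b := Pi.basisFun ℝ (Fin n)
  let L := Submodule.span ℤ (Set.range b)
  have hfin : Module.finrank ℤ L = n := by
    rw [Module.finrank_eq_card_basis (b.restrictScalars ℤ)]
    simp
  have hs := ZLattice.summable_norm_rpow L r (by rw [hfin]; exact hr)
  have hmem : ∀ k : Fin n → ℤ, (fun j => (k j : ℝ)) ∈ L := by
    intro k
    refine (b.mem_span_iff_repr_mem ℤ _).2 fun i => ⟨k i, ?_⟩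
    simp [b]
  have hinj : Function.Injective (fun k : Fin n → ℤ => (⟨fun j => (k j : ℝ), hmem k⟩ : L)) := by
    intro k l h
    have h1 := congrArg Subtype.val h
    funext j
    have : (k j : ℝ) = (l j : ℝ) := congrFun h1 j
    exact_mod_cast this
  refine (hs.comp_injective hinj).congr fun k => ?_
  simp only [Function.comp]
  congr 1

/-- Measure of the intersection of a box with a strip. -/
lemma dioph_strip (n : ℕ) (v : Fin n → ℝ) (j : Fin n) (hj : v j ≠ 0) (R : ℝ) (δ : ℝ) :
    volume {ω : Fin n → ℝ | (∀ i, |ω i| < R) ∧ |∑ i, v i * ω i| < δ} ≤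
      ENNReal.ofReal |(v j)⁻¹| * (ENNReal.ofReal (2 * δ) * ENNReal.ofReal (2 * R) ^ (n - 1)) := by
  let M : Matrix (Fin n) (Fin n) ℝ := (1 : Matrix (Fin n) (Fin n) ℝ).updateRow j v
  have hdet : LinearMap.det (Matrix.toLin' M) = v j := by
    rw [LinearMap.det_toLin', ← Matrix.cramer_transpose_apply, Matrix.transpose_one,
      Matrix.cramer_one]
    rfl
  let c : Fin n → ℝ := Function.update (fun _ => R) j δ
  have hsub : {ω : Fin n → ℝ | (∀ i, |ω i| < R) ∧ |∑ i, v i * ω i| < δ} ⊆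
      (Matrix.toLin' M) ⁻¹' (Set.pi Set.univ fun i => Set.Ioo (-c i) (c i)) := by
    rintro ω ⟨h1, h2⟩ i -
    rw [Set.mem_Ioo, ← abs_lt]
    by_cases hi : i = j
    · subst hi
      simpa [M, c, Matrix.mulVec, dotProduct] using h2
    · have : (Matrix.toLin' M) ω i = ω i := by
        rw [Matrix.toLin'_apply]
        simp only [M, Matrix.mulVec]
        rw [Matrix.updateRow_ne hi]
        exact congrFun (Matrix.one_mulVec ω) i
      rw [this]
      simpa [c, hi] using h1 i
  refine (measure_mono hsub).trans ?_
  rw [Measure.addHaar_preimage_linearMap _ (by rw [hdet]; exact hj), hdet, Real.volume_pi_Ioo]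
  refine mul_le_mul_right (le_of_eq ?_) _
  rw [← Finset.mul_prod_erase _ _ (Finset.mem_univ j)]
  congr 1
  · simp [c, two_mul]
  · rw [Finset.prod_congr rfl (g := fun _ => ENNReal.ofReal (2 * R))]
    · simp
    · intro i hi
      simp [c, Finset.ne_of_mem_erase hi, two_mul]

/-- For a nonzero integer vector, the measure of the resonant zone in a box. -/
lemma dioph_zone (n : ℕ) (τ : ℝ) (hτ : 0 ≤ τ) (R α : ℝ) (hα : 0 < α)
    (k : Fin n → ℤ) (hk : k ≠ 0) :
    volume {ω : Fin n → ℝ | (∀ i, |ω i| < R) ∧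
        |∑ j, (k j : ℝ) * ω j| < α / ((∑ j, |k j| : ℤ) : ℝ) ^ τ} ≤
      ENNReal.ofReal α * (ENNReal.ofReal (2 * ‖k‖ ^ (-(τ + 1))) *
        ENNReal.ofReal (2 * R) ^ (n - 1)) := by
  have hne : Nonempty (Fin n) := by
    by_contra h
    rw [not_nonempty_iff] at h
    exact hk (Subsingleton.elim _ _)
  have hpos : 0 < ‖k‖ := norm_pos_iff.2 hk
  obtain ⟨j, hj⟩ : ∃ j, ‖k‖ = |(k j : ℝ)| := by
    obtain ⟨j, -, hj⟩ := Finset.exists_mem_eq_sup' (Finset.univ_nonempty (α := Fin n))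
      (fun i => ‖k i‖)
    refine ⟨j, le_antisymm ?_ ?_⟩
    · refine (pi_norm_le_iff_of_nonneg (abs_nonneg _)).2 fun i => ?_
      have := Finset.le_sup' (fun i => ‖k i‖) (Finset.mem_univ i)
      rw [hj] at this
      simpa [Int.norm_eq_abs] using this
    · rw [← Int.norm_eq_abs]
      exact norm_le_pi_norm k j
  have hj0 : (k j : ℝ) ≠ 0 := by
    rw [← abs_pos, ← hj]; exact hpos
  have hle : ‖k‖ ≤ ((∑ j, |k j| : ℤ) : ℝ) := by
    rw [hj]
    exact_mod_cast Finset.single_le_sum (f := fun i => |k i|) (fun i _ => abs_nonneg (k i))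
      (Finset.mem_univ j)
  refine (dioph_strip n (fun i => (k i : ℝ)) j hj0 R _).trans ?_
  rw [← mul_assoc, ← mul_assoc, ← ENNReal.ofReal_mul (abs_nonneg _), ← ENNReal.ofReal_mul hα.le]
  refine mul_le_mul_left (ENNReal.ofReal_le_ofReal ?_) _
  rw [abs_inv, ← hj, Real.rpow_neg hpos.le, Real.rpow_add hpos, Real.rpow_one]
  have h1 : α / ((∑ j, |k j| : ℤ) : ℝ) ^ τ ≤ α / ‖k‖ ^ τ := by
    gcongr
  calc ‖k‖⁻¹ * (2 * (α / ((∑ j, |k j| : ℤ) : ℝ) ^ τ)) ≤ ‖k‖⁻¹ * (2 * (α / ‖k‖ ^ τ)) := by gcongr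
    _ = α * (2 * (‖k‖ ^ τ * ‖k‖)⁻¹) := by
      rw [mul_inv]; ring

/-- Diophantine frequencies have full measure: for `τ > n-1` the set of `ω` that
fail every diophantine condition (`R^τ`) has Lebesgue measure zero, i.e. almost
every `ω ∈ ℝⁿ` is `(α,τ)`-diophantine for some `α > 0`. -/
theorem diophantine_full_measure (n : ℕ) (hn : 1 ≤ n) (τ : ℝ) (hτ : (n : ℝ) - 1 < τ) :
    volume {ω : Fin n → ℝ | ∀ α : ℝ, 0 < α →
      ∃ k : Fin n → ℤ, k ≠ 0 ∧
        |∑ j, (k j : ℝ) * ω j| < α / ((∑ j, |k j| : ℤ) : ℝ) ^ τ} = 0 := by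
  have hτ0 : 0 ≤ τ := by
    have : (1 : ℝ) ≤ n := by exact_mod_cast hn
    linarith
  set S := {ω : Fin n → ℝ | ∀ α : ℝ, 0 < α →
      ∃ k : Fin n → ℤ, k ≠ 0 ∧
        |∑ j, (k j : ℝ) * ω j| < α / ((∑ j, |k j| : ℤ) : ℝ) ^ τ} with hS
  have hcover : S ⊆ ⋃ N : ℕ, (S ∩ {ω | ∀ i, |ω i| < (N : ℝ)}) := by
    intro ω hω
    obtain ⟨N, hN⟩ := exists_nat_gt ‖ω‖
    exact Set.mem_iUnion.2 ⟨N, hω, fun i => (norm_le_pi_norm ω i).trans_lt hN⟩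
  refine measure_mono_null hcover (measure_iUnion_null fun N => ?_)
  let K : ENNReal := ∑' k : Fin n → ℤ, (ENNReal.ofReal (2 * ‖k‖ ^ (-(τ + 1))) *
        ENNReal.ofReal (2 * (N : ℝ)) ^ (n - 1))
  have hK : K ≠ ⊤ := by
    simp only [K]
    rw [ENNReal.tsum_mul_right]
    refine ENNReal.mul_ne_top ?_ (ENNReal.pow_ne_top ENNReal.ofReal_ne_top)
    exact ((dioph_summable n (-(τ + 1)) (by linarith)).mul_left 2).tsum_ofReal_ne_top
  have hbound : ∀ α : ℝ, 0 < α →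
      volume (S ∩ {ω | ∀ i, |ω i| < (N : ℝ)}) ≤ ENNReal.ofReal α * K := by
    intro α hα
    let Z : (Fin n → ℤ) → Set (Fin n → ℝ) := fun k => {ω | k ≠ 0 ∧ (∀ i, |ω i| < (N : ℝ)) ∧
        |∑ j, (k j : ℝ) * ω j| < α / ((∑ j, |k j| : ℤ) : ℝ) ^ τ}
    have hsub : S ∩ {ω | ∀ i, |ω i| < (N : ℝ)} ⊆ ⋃ k, Z k := by
      rintro ω ⟨h1, h2⟩
      obtain ⟨k, hk, hlt⟩ := h1 α hα
      exact Set.mem_iUnion.2 ⟨k, hk, h2, hlt⟩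
    refine (measure_mono hsub).trans ((measure_iUnion_le _).trans ?_)
    simp only [K]
    rw [← ENNReal.tsum_mul_left]
    refine ENNReal.tsum_le_tsum fun k => ?_
    by_cases hk : k = 0
    · have : Z k = ∅ := by
        ext ω; simp [Z, hk]
      rw [this]; simp
    · exact (measure_mono fun ω hω => hω.2).trans (dioph_zone n τ hτ0 N α hα k hk)
  have hlim : Filter.Tendsto (fun α : ℝ => ENNReal.ofReal α * K) (nhdsWithin 0 (Set.Ioi 0))
      (nhds 0) := by
    have h0 : Filter.Tendsto (fun α : ℝ => ENNReal.ofReal α) (nhdsWithin 0 (Set.Ioi 0))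
        (nhds 0) := by
      have := (ENNReal.continuous_ofReal.tendsto 0).mono_left
        (nhdsWithin_le_nhds (s := Set.Ioi (0 : ℝ)))
      simpa using this
    have := ENNReal.Tendsto.mul_const (b := K) h0 (Or.inr hK)
    simpa using this
  refine le_antisymm (ge_of_tendsto hlim ?_) zero_le
  filter_upwards [self_mem_nhdsWithin] with α hα
  exact hbound α hα
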